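/- For every integer k ≥ 8 there exist k(k+1) points in the closed unit square [0,1]² whose pairwise distances are all strictly greater than (k² + 1)/(k·(k² − k + √(2k))). Consequently, the main alternating-column pattern of k(k+1) disks is not an optimal packing for any k ≥ 8. -/

import Mathlib

/-- In the unit-length zigzag grid with horizontal steps `(c, ±s)` and vertical steps `(±g, h)`,
distinct points are at distance at least `1`. Here `A`, `B` are the index differences and
`E`, `F` the corresponding differences of parities. -/
lemma one_le_sq_dist_zigzag {c s g h : ℝ} (hs : 0 ≤ s) (hg : 0 ≤ g) (hcs : c ^ 2 + s ^ 2 = 1)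
    (hgh : g ^ 2 + h ^ 2 = 1) (hcross : c * g + h * s = 1 / 2) (hs' : s ≤ 1 / 2) (hg' : g ≤ 1 / 2)
    (hc : 0 ≤ c) (hh : 0 ≤ h) {A B E F : ℤ}
    (hA : A = 0 ∧ F = 0 ∨ (A = 1 ∨ A = -1) ∧ (F = 1 ∨ F = -1) ∨ 2 ≤ A ∨ A ≤ -2)
    (hB : B = 0 ∧ E = 0 ∨ (B = 1 ∨ B = -1) ∧ (E = 1 ∨ E = -1) ∨ 2 ≤ B ∨ B ≤ -2)
    (hE : -1 ≤ E ∧ E ≤ 1) (hF : -1 ≤ F ∧ F ≤ 1) (hAB : A ≠ 0 ∨ B ≠ 0) :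
    1 ≤ ((A : ℝ) * c + E * g) ^ 2 + ((B : ℝ) * h + F * s) ^ 2 := by
  have hc' : 3 / 4 ≤ c := by nlinarith
  have hh' : 3 / 4 ≤ h := by nlinarith
  have far : ∀ {M N : ℤ} {x y : ℝ}, 3 / 4 ≤ x → 0 ≤ y → y ≤ 1 / 2 → (2 ≤ M ∨ M ≤ -2) →
      (-1 ≤ N ∧ N ≤ 1) → 1 ≤ ((M : ℝ) * x + N * y) ^ 2 := by
    intro M N x y hx hy hy' hM hN
    have h1 : (-1 : ℝ) ≤ N := by exact_mod_cast hN.1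
    have h2 : (N : ℝ) ≤ 1 := by exact_mod_cast hN.2
    have h3 : -y ≤ N * y := by nlinarith
    have h4 : N * y ≤ y := by nlinarith
    rw [one_le_sq_iff_one_le_abs, le_abs']
    rcases hM with hM | hM
    · have h5 : (2 : ℝ) ≤ M := by exact_mod_cast hM
      right; nlinarith
    · have h5 : (M : ℝ) ≤ -2 := by exact_mod_cast hM
      left; nlinarith
  have hcg : 0 ≤ c * g := by positivity
  have hhs : 0 ≤ h * s := by positivity
  rcases hA with ⟨hA, hF0⟩ | ⟨hA, hF1⟩ | hA
  · rcases hB with ⟨hB, -⟩ | ⟨hB, hE1⟩ | hB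
    · omega
    · subst hA hF0
      rcases hB with rfl | rfl <;> rcases hE1 with rfl | rfl <;> push_cast <;> nlinarith
    · nlinarith [far hh' hs hs' hB hF, sq_nonneg ((A : ℝ) * c + E * g)]
  · rcases hB with ⟨hB, hE0⟩ | ⟨hB, hE1⟩ | hB
    · subst hB hE0
      rcases hA with rfl | rfl <;> rcases hF1 with rfl | rfl <;> push_cast <;> nlinarith
    · rcases hA with rfl | rfl <;> rcases hF1 with rfl | rfl <;> rcases hB with rfl | rfl <;>
        rcases hE1 with rfl | rfl <;> push_cast <;> nlinarith
    · nlinarith [far hh' hs hs' hB hF, sq_nonneg ((A : ℝ) * c + E * g)]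
  · nlinarith [far hc' hg hg' hA hE, sq_nonneg ((B : ℝ) * h + F * s)]

/-- The diameter of the main pattern is smaller than that of the alternative pattern, the latter in
the closed form `√(8k² + 8 - 4√3(k² - k - 1)) / (k² + 3k - 1)`. -/
lemma main_diameter_lt_alternative_diameter {k : ℝ} (hk : 8 ≤ k) :
    (k ^ 2 + 1) / (k * (k ^ 2 - k + √(2 * k))) <
      √(8 * k ^ 2 + 8 - 4 * √3 * (k ^ 2 - k - 1)) / (k ^ 2 + 3 * k - 1) := by
  have h3 : √3 ≤ 1.73206 := by
    rw [Real.sqrt_le_left (by norm_num)]; norm_num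
  obtain ⟨t, ht, hr⟩ : ∃ t : ℝ, 0 ≤ t ∧ √(2 * k) = 4 + t := by
    refine ⟨√(2 * k) - 4, ?_, by ring⟩
    have : (4 : ℝ) ≤ √(2 * k) := Real.le_sqrt_of_sq_le (by linarith)
    linarith
  have hkt : k = (4 + t) ^ 2 / 2 := by
    rw [← hr, Real.sq_sqrt (by linarith)]; ring
  rw [hr, div_lt_div_iff₀ (by nlinarith) (by nlinarith), mul_comm (√_),
    ← div_lt_iff₀' (by nlinarith)]
  refine Real.lt_sqrt_of_sq_lt ?_
  have hD : 8 * k ^ 2 + 8 - 4 * 1.73206 * (k ^ 2 - k - 1) ≤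
      8 * k ^ 2 + 8 - 4 * √3 * (k ^ 2 - k - 1) := by
    nlinarith [mul_nonneg (sub_nonneg.2 h3) (show 0 ≤ k ^ 2 - k - 1 by nlinarith)]
  refine lt_of_lt_of_le ?_ hD
  rw [div_pow, div_lt_iff₀ (by have : 0 < k * (k ^ 2 - k + (4 + t)) := by nlinarith
                               positivity), ← sub_pos, hkt]
  ring_nf
  positivity

lemma parity_sub_cases (m n : ℕ) :
    ((m : ℤ) - n = 0 ∧ ((m % 2 : ℕ) : ℤ) - (n % 2 : ℕ) = 0 ∨
      ((m : ℤ) - n = 1 ∨ (m : ℤ) - n = -1) ∧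
        (((m % 2 : ℕ) : ℤ) - (n % 2 : ℕ) = 1 ∨ ((m % 2 : ℕ) : ℤ) - (n % 2 : ℕ) = -1) ∨
      2 ≤ (m : ℤ) - n ∨ (m : ℤ) - n ≤ -2) ∧
    -1 ≤ ((m % 2 : ℕ) : ℤ) - (n % 2 : ℕ) ∧ ((m % 2 : ℕ) : ℤ) - (n % 2 : ℕ) ≤ 1 := by
  omega

/-- The alternative pattern: a `k × (k + 1)` zigzag grid inscribed in the unit square. -/
lemma exists_alternative_pattern {k : ℕ} (hk : 4 ≤ k) :
    ∃ f : Fin (k * (k + 1)) → EuclideanSpace ℝ (Fin 2),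
      (∀ i t, f i t ∈ Set.Icc (0 : ℝ) 1) ∧
      ∀ i j, i ≠ j →
        √(8 * (k : ℝ) ^ 2 + 8 - 4 * √3 * ((k : ℝ) ^ 2 - k - 1)) / ((k : ℝ) ^ 2 + 3 * k - 1) ≤
          dist (f i) (f j) := by
  have hk' : (4 : ℝ) ≤ k := by exact_mod_cast hk
  have hw : √3 ^ 2 = (3 : ℝ) := Real.sq_sqrt (by norm_num)
  have hw1 : √3 ≤ 1.74 := by rw [Real.sqrt_le_left (by norm_num)]; norm_num
  have hw0 : 0 ≤ √3 := Real.sqrt_nonneg 3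
  set w : ℝ := √3
  obtain ⟨K, hK⟩ : ∃ K : ℝ, (k : ℝ) = K := ⟨_, rfl⟩
  rw [hK] at hk' ⊢
  obtain ⟨q, hq⟩ : ∃ q, q = K + 1 + w := ⟨_, rfl⟩
  obtain ⟨p, hp⟩ : ∃ p, p = 2 * K + 1 - w * (K - 1) := ⟨_, rfl⟩
  have hD : 8 * K ^ 2 + 8 - 4 * w * (K ^ 2 - K - 1) = q ^ 2 + p ^ 2 := by
    rw [hq, hp]; linear_combination (-(1 + (K - 1) ^ 2)) * hw
  rw [hD]
  have hq0 : 0 < q := by rw [hq]; positivity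
  have hp0 : 0 ≤ p := by rw [hp]; nlinarith
  have hpq : w * p ≤ q := by
    have : q - w * p = (4 - 2 * w) * K - 2 := by
      rw [hq, hp]; linear_combination (K - 1) * hw
    nlinarith
  have hR2 : √(q ^ 2 + p ^ 2) ^ 2 = q ^ 2 + p ^ 2 := Real.sq_sqrt (by positivity)
  have hR : 0 < √(q ^ 2 + p ^ 2) := Real.sqrt_pos.2 (by positivity)
  set R := √(q ^ 2 + p ^ 2)
  obtain ⟨c, hc⟩ : ∃ c, c = q / R := ⟨_, rfl⟩
  obtain ⟨s, hs⟩ : ∃ s, s = p / R := ⟨_, rfl⟩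
  obtain ⟨g, hg⟩ : ∃ g, g = c / 2 - w / 2 * s := ⟨_, rfl⟩
  obtain ⟨h, hh⟩ : ∃ h, h = w / 2 * c + s / 2 := ⟨_, rfl⟩
  have hcs : c ^ 2 + s ^ 2 = 1 := by
    rw [hc, hs]; field_simp; exact hR2.symm
  have hc0 : 0 ≤ c := by rw [hc]; positivity
  have hs0 : 0 ≤ s := by rw [hs]; positivity
  have hcw : w * s ≤ c := by
    rw [hc, hs, ← mul_div_assoc]; gcongr
  have hg0 : 0 ≤ g := by rw [hg]; linarith
  have hh0 : 0 ≤ h := by rw [hh]; positivity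
  have hs2 : s ≤ 1 / 2 := by
    have : (w * s) ^ 2 ≤ c ^ 2 := by gcongr
    rw [mul_pow, hw] at this
    nlinarith
  have hg2 : g ≤ 1 / 2 := by
    have h1 : c ≤ 1 := by nlinarith
    have h2 : 0 ≤ w * s := by positivity
    rw [hg]; linarith
  have hgh : g ^ 2 + h ^ 2 = 1 := by
    rw [hg, hh]; linear_combination hcs + (c ^ 2 + s ^ 2) / 4 * hw
  have hcross : c * g + h * s = 1 / 2 := by
    rw [hg, hh]; linear_combination hcs / 2
  obtain ⟨L, hL⟩ : ∃ L, L = (K ^ 2 + 3 * K - 1) / R := ⟨_, rfl⟩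
  have hL0 : 0 < L := by
    rw [hL]; exact div_pos (by nlinarith) hR
  have hwidth : K * c + g = L := by
    rw [hg, hc, hs, hL]; field_simp
    rw [hq, hp]; linear_combination (K - 1) * hw
  have hheight : (K - 1) * h + s = L := by
    rw [hh, hc, hs, hL]; field_simp
    rw [hq, hp]; linear_combination (K - 1) * hw
  have hdiam : R / (K ^ 2 + 3 * K - 1) = 1 / L := by rw [hL, one_div_div]
  rw [hdiam]
  let e : Fin (k * (k + 1)) ≃ Fin k × Fin (k + 1) := finProdFinEquiv.symm
  have parity : ∀ n : ℕ, (0 : ℝ) ≤ (n % 2 : ℕ) ∧ ((n % 2 : ℕ) : ℝ) ≤ 1 := fun n =>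
    ⟨by positivity, by exact_mod_cast (by omega : n % 2 ≤ 1)⟩
  refine ⟨fun n => !₂[((((e n).2 : ℕ) : ℝ) * c + (((e n).1 : ℕ) % 2 : ℕ) * g) / L,
    ((((e n).1 : ℕ) : ℝ) * h + (((e n).2 : ℕ) % 2 : ℕ) * s) / L], ?_, ?_⟩
  · intro n
    have hi : (((e n).2 : ℕ) : ℝ) ≤ K := by
      rw [← hK]; exact_mod_cast Nat.lt_succ_iff.1 (e n).2.2
    have hj : (((e n).1 : ℕ) : ℝ) ≤ K - 1 := by
      have : (((e n).1 : ℕ) : ℝ) + 1 ≤ K := by rw [← hK]; exact_mod_cast (e n).1.2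
      linarith
    obtain ⟨h1, h2⟩ := parity (e n).1
    obtain ⟨h3, h4⟩ := parity (e n).2
    rw [Fin.forall_fin_two]
    constructor
    · refine ⟨by simp only [Matrix.cons_val_zero]; positivity, ?_⟩
      simp only [Matrix.cons_val_zero]
      rw [div_le_one hL0, ← hwidth]
      linarith [mul_le_mul_of_nonneg_right hi hc0, mul_le_mul_of_nonneg_right h2 hg0]
    · refine ⟨by simp only [Matrix.cons_val_one, Matrix.cons_val_zero]; positivity, ?_⟩
      simp only [Matrix.cons_val_one, Matrix.cons_val_zero]
      rw [div_le_one hL0, ← hheight]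
      linarith [mul_le_mul_of_nonneg_right hj hh0, mul_le_mul_of_nonneg_right h4 hs0]
  · intro m n hmn
    obtain ⟨hA, hF⟩ := parity_sub_cases (e m).2 (e n).2
    obtain ⟨hB, hE⟩ := parity_sub_cases (e m).1 (e n).1
    have hne : (((e m).2 : ℕ) : ℤ) - ((e n).2 : ℕ) ≠ 0 ∨
        (((e m).1 : ℕ) : ℤ) - ((e n).1 : ℕ) ≠ 0 := by
      by_contra! hcon
      refine hmn (e.injective (Prod.ext (Fin.ext ?_) (Fin.ext ?_))) <;> omega
    have key := one_le_sq_dist_zigzag hs0 hg0 hcs hgh hcross hs2 hg2 hc0 hh0 hA hB hE hF hne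
    rw [EuclideanSpace.dist_eq]
    refine Real.le_sqrt_of_sq_le ?_
    rw [Fin.sum_univ_two, Real.dist_eq, Real.dist_eq, sq_abs, sq_abs, div_pow, one_pow,
      div_le_iff₀ (by positivity)]
    refine key.trans_eq ?_
    simp only [Int.cast_sub, Int.cast_natCast, Matrix.cons_val_one, Matrix.cons_val_zero]
    field_simp
    ring

/-- For every integer `k ≥ 8` there exist `k(k+1)` points in the closed unit square
whose pairwise distances are all strictly greater than
`(k² + 1) / (k (k² - k + √(2k)))`. -/
theorem stmt_11 (k : ℕ) (hk : 8 ≤ k) :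
    ∃ f : Fin (k * (k + 1)) → EuclideanSpace ℝ (Fin 2),
      (∀ i t, f i t ∈ Set.Icc (0 : ℝ) 1) ∧
      ∀ i j, i ≠ j →
        ((k : ℝ) ^ 2 + 1) / ((k : ℝ) * ((k : ℝ) ^ 2 - k + Real.sqrt (2 * k))) <
          dist (f i) (f j) := by
  obtain ⟨f, hf, hd⟩ := exists_alternative_pattern (k := k) (by omega)
  exact ⟨f, hf, fun i j hij =>
    (main_diameter_lt_alternative_diameter (by exact_mod_cast hk)).trans_le (hd i j hij)⟩
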